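/- Let q and q′ be nondegenerate quadratic forms of rank 3 over a field k of characteristic ≠ 2. Then the conic function fields k(q) and k(q′) are isomorphic as k-algebras if and only if q and q′ are similar. -/

import Mathlib

open scoped TensorProduct
open Quaternion
set_option synthInstance.maxHeartbeats 1000000
set_option maxHeartbeats 1000000
noncomputable section

universe u v

/-- Upper-triangular coefficient matrix of a quadratic form on `Fin n → R`. -/
def coeffMatrix {R : Type*} [CommRing R] {n : ℕ} (q : QuadraticForm R (Fin n → R)) :
    Matrix (Fin n) (Fin n) R :=
  Matrix.of fun i j =>
    if i = j then q (Pi.single i 1)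
    else if i < j then QuadraticMap.polar q (Pi.single i 1) (Pi.single j 1)
    else 0

/-- Base change of a quadratic form on `Fin n → R` along `R → l`. -/
def extendQF {R : Type*} [CommRing R] {n : ℕ} (q : QuadraticForm R (Fin n → R))
    (l : Type*) [CommRing l] [Algebra R l] : QuadraticForm l (Fin n → l) :=
  ((coeffMatrix q).map (algebraMap R l)).toQuadraticMap'

/-- Gram matrix of the polar bilinear form of `q`. -/
def polarMatrix {R : Type*} [CommRing R] {n : ℕ} (q : QuadraticForm R (Fin n → R)) :
    Matrix (Fin n) (Fin n) R :=
  Matrix.of fun i j => QuadraticMap.polar q (Pi.single i 1) (Pi.single j 1)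

/-- Discriminant: determinant of the Gram matrix (well defined up to squares). -/
def discQF {R : Type*} [CommRing R] {n : ℕ} (q : QuadraticForm R (Fin n → R)) : R :=
  (polarMatrix q).det

/-- Nondegeneracy (char ≠ 2): the Gram determinant is nonzero. -/
def NondegQF {R : Type*} [CommRing R] {n : ℕ} (q : QuadraticForm R (Fin n → R)) : Prop :=
  discQF q ≠ 0

/-- Two quadratic forms are similar if one is isometric to a unit scaling of the other. -/
def SimilarQF {R : Type*} [CommRing R] {n : ℕ} (q q' : QuadraticForm R (Fin n → R)) : Prop :=
  ∃ c : R, IsUnit c ∧ QuadraticMap.Equivalent (c • q) q'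

/-- The polynomial `q(X₁, …, X_{n-1}, 1)` defining the affine quadric. -/
def affineQuadricPoly {R : Type*} [CommRing R] {n : ℕ} (q : QuadraticForm R (Fin n → R)) :
    MvPolynomial (Fin (n - 1)) R :=
  (extendQF q (MvPolynomial (Fin (n - 1)) R))
    (fun i => if h : (i : ℕ) < n - 1 then MvPolynomial.X ⟨i, h⟩ else 1)

/-- Affine coordinate ring `R[x₁,…,x_{n-1}]/(q(x₁,…,x_{n-1},1))` of the quadric. -/
abbrev quadricCoordRing {R : Type*} [CommRing R] {n : ℕ}
    (q : QuadraticForm R (Fin n → R)) : Type _ :=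
  MvPolynomial (Fin (n - 1)) R ⧸ Ideal.span {affineQuadricPoly q}

/-- Function field `k(q)` of the quadric hypersurface `q = 0`. -/
abbrev quadricFunctionField {R : Type*} [CommRing R] {n : ℕ}
    (q : QuadraticForm R (Fin n → R)) : Type _ :=
  FractionRing (quadricCoordRing q)

/-- Affine coordinate ring `k[x,y]/(ax²+by²-1)` of the conic `C_{a,b}`. -/
abbrev conicCoordRing (k : Type*) [Field k] (a b : k) : Type _ :=
  MvPolynomial (Fin 2) k ⧸
    Ideal.span {(MvPolynomial.C a * MvPolynomial.X 0 ^ 2 +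
      MvPolynomial.C b * MvPolynomial.X 1 ^ 2 - 1 : MvPolynomial (Fin 2) k)}

/-- The conic function field `k(C_{a,b})`. -/
abbrev conicFunctionField (k : Type*) [Field k] (a b : k) : Type _ :=
  FractionRing (conicCoordRing k a b)

/-- A `k`-algebra is split if it is isomorphic to a matrix algebra over `k`. -/
def IsSplitAlg (k A : Type*) [Field k] [Ring A] [Algebra k A] : Prop :=
  ∃ n : ℕ, 0 < n ∧ Nonempty (A ≃ₐ[k] Matrix (Fin n) (Fin n) k)

/-- `A` is split by the extension `K/k`: the class of `A` lies in the Brauer kernel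
`κ(K/k) = ker (Br k → Br K)`. -/
def SplitsIn (k : Type*) [Field k] (A : Type*) [Ring A] [Algebra k A]
    (K : Type*) [CommRing K] [Algebra k K] : Prop :=
  ∃ n : ℕ, 0 < n ∧ Nonempty ((K ⊗[k] A) ≃ₐ[K] Matrix (Fin n) (Fin n) K)

/-- Brauer equivalence of two `k`-algebras. -/
def BrauerEquiv (k A B : Type*) [Field k] [Ring A] [Algebra k A] [Ring B] [Algebra k B] :
    Prop :=
  ∃ n m : ℕ, 0 < n ∧ 0 < m ∧
    Nonempty (Matrix (Fin n) (Fin n) A ≃ₐ[k] Matrix (Fin m) (Fin m) B)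

/-- A field is finitely generated (over its prime subfield). -/
def FieldFG (K : Type*) [Field K] : Prop :=
  ∃ s : Finset K, Subfield.closure (s : Set K) = ⊤

/-- Elementary equivalence in the first-order language of rings. -/
def ElemEquivRing (K₁ : Type*) (K₂ : Type*) [CommRing K₁] [CommRing K₂] : Prop :=
  letI := FirstOrder.Ring.compatibleRingOfRing K₁
  letI := FirstOrder.Ring.compatibleRingOfRing K₂
  FirstOrder.Language.ring.ElementarilyEquivalent K₁ K₂

/-- The `m`-fold Pfister form `⟨⟨a₁,…,aₘ⟩⟩ = ⟨1,a₁⟩ ⊗ ⋯ ⊗ ⟨1,aₘ⟩`. -/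
def pfisterForm {k : Type*} [Field k] {m : ℕ} (a : Fin m → k) :
    QuadraticForm k (Fin (2 ^ m) → k) :=
  QuadraticMap.weightedSumSquares k
    (fun j : Fin (2 ^ m) => ∏ i : Fin m, if Nat.testBit (j : ℕ) (i : ℕ) then a i else 1)

section BaseChange

variable {k : Type*} [Field k]

theorem extendQF_apply {n : ℕ} (q : QuadraticForm k (Fin n → k)) (A : Type*) [CommRing A]
    [Algebra k A] (v : Fin n → A) :
    extendQF q A v = ∑ i, ∑ j, algebraMap k A (coeffMatrix q i j) * v i * v j := by
  change Matrix.toLinearMap₂' A ((coeffMatrix q).map (algebraMap k A)) v v = _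
  rw [Matrix.toLinearMap₂'_apply]
  refine Finset.sum_congr rfl fun i _ => Finset.sum_congr rfl fun j _ => ?_
  simp only [Matrix.map_apply, smul_eq_mul]
  ring

theorem map_extendQF {n : ℕ} (q : QuadraticForm k (Fin n → k)) {A B : Type*} [CommRing A]
    [Algebra k A] [CommRing B] [Algebra k B] (g : A →ₐ[k] B) (v : Fin n → A) :
    g (extendQF q A v) = extendQF q B (fun i => g (v i)) := by
  simp [extendQF_apply]

theorem polar_eq_sum {n : ℕ} (q : QuadraticForm k (Fin n → k)) (v w : Fin n → k) :
    QuadraticMap.polar q v w = ∑ i, ∑ j, polarMatrix q i j * v i * w j := by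
  have hs (x : Fin n → k) : x = ∑ i, x i • (Pi.single i 1 : Fin n → k) := by
    simpa [← Pi.single_smul] using (Finset.univ_sum_single x).symm
  conv_lhs => rw [hs v, hs w]
  simp only [← QuadraticMap.polarBilin_apply_apply, map_sum, LinearMap.sum_apply, map_smul,
    LinearMap.smul_apply, smul_eq_mul]
  rw [Finset.sum_comm]
  refine Finset.sum_congr rfl fun i _ => ?_
  rw [Finset.mul_sum]
  refine Finset.sum_congr rfl fun j _ => ?_
  simp only [QuadraticMap.polarBilin_apply_apply, polarMatrix, Matrix.of_apply]
  ring

theorem two_mul_extendQF (q : QuadraticForm k (Fin 3 → k)) (A : Type*) [CommRing A]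
    [Algebra k A] (v : Fin 3 → A) :
    2 * extendQF q A v = ∑ i, ∑ j, algebraMap k A (polarMatrix q i j) * v i * v j := by
  have h10 := QuadraticMap.polar_comm q (Pi.single 1 1) (Pi.single 0 1)
  have h20 := QuadraticMap.polar_comm q (Pi.single 2 1) (Pi.single 0 1)
  have h21 := QuadraticMap.polar_comm q (Pi.single 2 1) (Pi.single 1 1)
  have hd (i : Fin 3) : QuadraticMap.polar q (Pi.single i 1) (Pi.single i 1)
      = 2 * q (Pi.single i 1) := by
    rw [QuadraticMap.polar_self, two_smul, two_mul]
  simp only [extendQF_apply, Fin.sum_univ_three, coeffMatrix, polarMatrix, Matrix.of_apply, h10,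
    h20, h21, hd, map_mul, map_ofNat]
  simp
  ring

/-- The scalar extension of the linear map `f` to `A`. -/
def extendLin (f : (Fin 3 → k) →ₗ[k] (Fin 3 → k)) (A : Type*) [CommRing A] [Algebra k A]
    (v : Fin 3 → A) : Fin 3 → A :=
  fun i => ∑ j, algebraMap k A (f (Pi.single j 1) i) * v j

theorem map_extendLin (f : (Fin 3 → k) →ₗ[k] (Fin 3 → k)) {A B : Type*} [CommRing A] [Algebra k A]
    [CommRing B] [Algebra k B] (g : A →ₐ[k] B) (v : Fin 3 → A) (i : Fin 3) :
    g (extendLin f A v i) = extendLin f B (fun i => g (v i)) i := by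
  simp [extendLin]

theorem extendLin_comp (f g : (Fin 3 → k) →ₗ[k] (Fin 3 → k)) (A : Type*) [CommRing A] [Algebra k A]
    (v : Fin 3 → A) : extendLin (f ∘ₗ g) A v = extendLin f A (extendLin g A v) := by
  have hf (w : Fin 3 → k) (i : Fin 3) : f w i = ∑ j, f (Pi.single j 1) i * w j := by
    conv_lhs => rw [← LinearMap.toMatrix'_mulVec f w]
    simp [Matrix.mulVec, dotProduct, LinearMap.toMatrix'_apply]
  ext i
  simp only [extendLin, LinearMap.comp_apply]
  simp_rw [hf (g _) i]
  simp only [Fin.sum_univ_three, map_add, map_mul]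
  ring

theorem extendLin_id (A : Type*) [CommRing A] [Algebra k A] (v : Fin 3 → A) :
    extendLin (LinearMap.id : (Fin 3 → k) →ₗ[k] (Fin 3 → k)) A v = v := by
  ext i
  simp [extendLin, Pi.single_apply]

theorem extendQF_extendLin (h2 : (2 : k) ≠ 0) {q q' : QuadraticForm k (Fin 3 → k)} {c : k}
    {f : (Fin 3 → k) →ₗ[k] (Fin 3 → k)} (hf : ∀ v, q' (f v) = c * q v) (A : Type*) [CommRing A]
    [Algebra k A] (v : Fin 3 → A) :
    extendQF q' A (extendLin f A v) = algebraMap k A c * extendQF q A v := by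
  have hu : IsUnit (2 : A) := by
    rw [← map_ofNat (algebraMap k A) 2]
    exact (IsUnit.mk0 _ h2).map _
  have hp (i j : Fin 3) : c * polarMatrix q i j =
      ∑ a, ∑ b, polarMatrix q' a b * f (Pi.single i 1) a * f (Pi.single j 1) b := by
    rw [← polar_eq_sum]
    simp only [QuadraticMap.polar, polarMatrix, Matrix.of_apply, ← map_add, hf]
    ring
  apply hu.mul_left_cancel
  rw [mul_left_comm, two_mul_extendQF, two_mul_extendQF]
  simp_rw [Finset.mul_sum, ← mul_assoc, ← map_mul, hp]
  simp only [extendLin, Fin.sum_univ_three, map_add, map_mul]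
  ring

end BaseChange

section Similar

variable {k : Type*} [Field k]

theorem similarQF_of_linearMap {q q' : QuadraticForm k (Fin 3 → k)} (hq : NondegQF q) {c : k}
    (hc : c ≠ 0) (f : (Fin 3 → k) →ₗ[k] (Fin 3 → k)) (hf : ∀ v, q' (f v) = c * q v) :
    SimilarQF q q' := by
  have hinj : Function.Injective f := by
    rw [injective_iff_map_eq_zero]
    intro v hv
    have hpol (w : Fin 3 → k) : QuadraticMap.polar q w v = 0 := by
      have h : c * QuadraticMap.polar q w v = QuadraticMap.polar q' (f w) (f v) := by
        simp only [QuadraticMap.polar, ← map_add, hf]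
        ring
      rw [hv, QuadraticMap.polar_zero_right] at h
      exact (mul_eq_zero.mp h).resolve_left hc
    refine Matrix.eq_zero_of_mulVec_eq_zero hq (funext fun i => ?_)
    have := hpol (Pi.single i 1)
    rw [polar_eq_sum] at this
    simpa [Matrix.mulVec, dotProduct, Pi.single_apply] using this
  refine ⟨c, IsUnit.mk0 c hc, ⟨⟨LinearEquiv.ofInjectiveEndo f hinj, fun v => ?_⟩⟩⟩
  exact hf v

theorem SimilarQF.exists_linearEquiv {q q' : QuadraticForm k (Fin 3 → k)} (h : SimilarQF q q') :
    ∃ c : k, c ≠ 0 ∧ ∃ f : (Fin 3 → k) ≃ₗ[k] (Fin 3 → k), ∀ v, q' (f v) = c * q v := by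
  obtain ⟨c, hc, ⟨e⟩⟩ := h
  exact ⟨c, hc.ne_zero, e.toLinearEquiv, fun v => by simp⟩

theorem SimilarQF.symm {q q' : QuadraticForm k (Fin 3 → k)} (hq' : NondegQF q')
    (h : SimilarQF q q') : SimilarQF q' q := by
  obtain ⟨c, hc, f, hf⟩ := h.exists_linearEquiv
  refine similarQF_of_linearMap hq' (inv_ne_zero hc) f.symm.toLinearMap fun v => ?_
  have := hf (f.symm v)
  rw [f.apply_symm_apply] at this
  rw [this, inv_mul_cancel_left₀ hc]
  rfl

theorem SimilarQF.trans {q₁ q₂ q₃ : QuadraticForm k (Fin 3 → k)} (hq : NondegQF q₁)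
    (h : SimilarQF q₁ q₂) (h' : SimilarQF q₂ q₃) : SimilarQF q₁ q₃ := by
  obtain ⟨c, hc, f, hf⟩ := h.exists_linearEquiv
  obtain ⟨d, hd, g, hg⟩ := h'.exists_linearEquiv
  refine similarQF_of_linearMap hq (mul_ne_zero hd hc) (g.toLinearMap ∘ₗ f.toLinearMap) fun v => ?_
  simp [hg, hf, mul_assoc]

end Similar

section QuadricPoly

open MvPolynomial

variable {k : Type*} [Field k]

/-- The quadratic form `q`, as a homogeneous polynomial of degree two. -/
def quadricPoly (q : QuadraticForm k (Fin 3 → k)) : MvPolynomial (Fin 3) k :=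
  extendQF q (MvPolynomial (Fin 3) k) X

theorem isHomogeneous_quadricPoly (q : QuadraticForm k (Fin 3 → k)) :
    (quadricPoly q).IsHomogeneous 2 := by
  rw [quadricPoly, extendQF_apply]
  refine IsHomogeneous.sum _ _ _ fun i _ => IsHomogeneous.sum _ _ _ fun j _ => ?_
  exact (((isHomogeneous_C (Fin 3) (coeffMatrix q i j)).mul (isHomogeneous_X k i)).mul
    (isHomogeneous_X k j))

theorem pderiv_pderiv_quadricPoly (h2 : (2 : k) ≠ 0) (q : QuadraticForm k (Fin 3 → k))
    (i j : Fin 3) : pderiv i (pderiv j (quadricPoly q)) = C (polarMatrix q i j) := by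
  have h2' : (C 2 : MvPolynomial (Fin 3) k) ≠ 0 := by simpa using h2
  have hsymm (a b : Fin 3) : polarMatrix q a b = polarMatrix q b a :=
    QuadraticMap.polar_comm q _ _
  have h := congrArg (fun p => pderiv i (pderiv j p))
    (two_mul_extendQF q (MvPolynomial (Fin 3) k) X)
  have hC : (2 : MvPolynomial (Fin 3) k) = C 2 := rfl
  simp only [hC, pderiv_C_mul, MvPolynomial.algebraMap_eq] at h
  refine mul_left_cancel₀ h2' ?_
  rw [quadricPoly, h, ← hC]
  simp only [Fin.sum_univ_three, map_add, mul_assoc, Derivation.leibniz,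
    hsymm 1 0, hsymm 2 0, hsymm 2 1]
  fin_cases i <;> fin_cases j <;>
    simp [pderiv_X, hsymm 1 0, hsymm 2 0, hsymm 2 1] <;> ring

theorem exists_pderiv_eq_C {σ : Type*} {f : MvPolynomial σ k} (hf : f.totalDegree = 1) (i : σ) :
    ∃ c, pderiv i f = C c := by
  rw [← sum_homogeneousComponent f, hf, Finset.sum_range_succ, Finset.sum_range_one, map_add,
    homogeneousComponent_zero, pderiv_C, zero_add]
  have h := (homogeneousComponent_isHomogeneous 1 f).pderiv (i := i)
  exact ⟨_, totalDegree_eq_zero_iff_eq_C.mp (Nat.le_zero.mp h.totalDegree_le)⟩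

theorem quadricPoly_ne_zero (h2 : (2 : k) ≠ 0) {q : QuadraticForm k (Fin 3 → k)}
    (hq : NondegQF q) : quadricPoly q ≠ 0 := by
  intro h0
  refine hq ?_
  have : polarMatrix q = 0 := by
    ext i j
    have h := pderiv_pderiv_quadricPoly h2 q i j
    rw [h0, map_zero, map_zero, eq_comm, C_eq_zero] at h
    exact h
  rw [discQF, this, Matrix.det_zero]

theorem totalDegree_quadricPoly (h2 : (2 : k) ≠ 0) {q : QuadraticForm k (Fin 3 → k)}
    (hq : NondegQF q) : (quadricPoly q).totalDegree = 2 :=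
  (isHomogeneous_quadricPoly q).totalDegree (quadricPoly_ne_zero h2 hq)

theorem isUnit_of_totalDegree_eq_zero {σ : Type*} {f : MvPolynomial σ k} (h0 : f ≠ 0)
    (hf : f.totalDegree = 0) : IsUnit f := by
  rw [totalDegree_eq_zero_iff_eq_C] at hf
  rw [hf] at h0 ⊢
  exact (IsUnit.mk0 _ fun h => h0 (by rw [h, map_zero])).map C

theorem irreducible_quadricPoly (h2 : (2 : k) ≠ 0) {q : QuadraticForm k (Fin 3 → k)}
    (hq : NondegQF q) : Irreducible (quadricPoly q) := by
  have hne := quadricPoly_ne_zero h2 hq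
  have hdeg := totalDegree_quadricPoly h2 hq
  constructor
  · intro hu
    have := (isUnit_iff_totalDegree_of_isReduced.mp hu).2
    omega
  · intro a b hab
    have ha : a ≠ 0 := by rintro rfl; simp_all
    have hb : b ≠ 0 := by rintro rfl; simp_all
    have hsum : a.totalDegree + b.totalDegree = 2 := by
      rw [← totalDegree_mul_of_isDomain ha hb, ← hab, hdeg]
    rcases Nat.lt_or_ge 0 a.totalDegree with ha0 | ha0
    swap
    · exact Or.inl (isUnit_of_totalDegree_eq_zero ha (by omega))
    rcases Nat.lt_or_ge 0 b.totalDegree with hb0 | hb0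
    swap
    · exact Or.inr (isUnit_of_totalDegree_eq_zero hb (by omega))
    exfalso
    choose α hα using exists_pderiv_eq_C (f := a) (by omega)
    choose β hβ using exists_pderiv_eq_C (f := b) (by omega)
    have hp (i j : Fin 3) : polarMatrix q i j = α i * β j + α j * β i := by
      apply C_injective (Fin 3) k
      rw [← pderiv_pderiv_quadricPoly h2, hab]
      simp only [Derivation.leibniz, hα, hβ, map_add, pderiv_C, smul_eq_mul, map_mul]
      ring
    refine hq ?_
    rw [discQF, Matrix.det_fin_three]
    simp only [hp]
    ring

theorem not_quadricPoly_dvd_X (h2 : (2 : k) ≠ 0) {q : QuadraticForm k (Fin 3 → k)}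
    (hq : NondegQF q) (i : Fin 3) : ¬ quadricPoly q ∣ X i := by
  intro h
  have := totalDegree_le_of_dvd_of_isDomain h (X_ne_zero i)
  rw [totalDegree_quadricPoly h2 hq, totalDegree_X] at this
  omega

end QuadricPoly

section GenericZero

open MvPolynomial
open scoped IntermediateField.algebraAdjoinAdjoin

variable {k : Type*} [Field k]

/-- The point `x` with coordinates in the `k`-algebra `E` is a generic zero of `q`: the polynomials
vanishing at `x` are the multiples of `q`. -/
def IsGenericZero (q : QuadraticForm k (Fin 3 → k)) {E : Type*} [Field E] [Algebra k E]
    (x : Fin 3 → E) : Prop :=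
  ∀ f : MvPolynomial (Fin 3) k, aeval x f = 0 ↔ quadricPoly q ∣ f

theorem aeval_quadricPoly (q : QuadraticForm k (Fin 3 → k)) {A : Type*} [CommRing A] [Algebra k A]
    (x : Fin 3 → A) : aeval x (quadricPoly q) = extendQF q A x := by
  rw [quadricPoly, map_extendQF]
  simp

theorem affineQuadricPoly_eq (q : QuadraticForm k (Fin 3 → k)) :
    affineQuadricPoly q =
      aeval (![X 0, X 1, 1] : Fin 3 → MvPolynomial (Fin (3 - 1)) k) (quadricPoly q) := by
  rw [aeval_quadricPoly, affineQuadricPoly]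
  congr 1
  ext1 i
  fin_cases i <;> rfl

variable {E : Type*} [Field E] [Algebra k E]

theorem exists_isGenericZero {k : Type u} [Field k] (h2 : (2 : k) ≠ 0)
    {q : QuadraticForm k (Fin 3 → k)} (hq : NondegQF q) :
    ∃ (E : Type u) (_ : Field E) (_ : Algebra k E) (x : Fin 3 → E), IsGenericZero q x := by
  have hprime : Prime (quadricPoly q) := (irreducible_quadricPoly h2 hq).prime
  have : (Ideal.span {quadricPoly q}).IsPrime :=
    (Ideal.span_singleton_prime hprime.ne_zero).mpr hprime
  let S := MvPolynomial (Fin 3) k ⧸ Ideal.span {quadricPoly q}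
  let g : MvPolynomial (Fin 3) k →ₐ[k] FractionRing S :=
    (IsScalarTower.toAlgHom k S (FractionRing S)).comp (Ideal.Quotient.mkₐ k _)
  refine ⟨FractionRing S, inferInstance, inferInstance, fun i => g (X i), fun f => ?_⟩
  have hg : aeval (fun i => g (X i)) f = g f := by
    conv_rhs => rw [aeval_unique g]
    rfl
  rw [hg, ← Ideal.mem_span_singleton, ← Ideal.Quotient.eq_zero_iff_mem]
  exact map_eq_zero_iff (algebraMap S (FractionRing S)) (IsFractionRing.injective _ _)

theorem IsGenericZero.coord_ne_zero (h2 : (2 : k) ≠ 0) {q : QuadraticForm k (Fin 3 → k)}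
    (hq : NondegQF q) {x : Fin 3 → E} (hx : IsGenericZero q x) (i : Fin 3) : x i ≠ 0 := by
  intro h
  refine not_quadricPoly_dvd_X h2 hq i ((hx _).mp ?_)
  rw [aeval_X, h]

theorem IsGenericZero.baseChangeLin (h2 : (2 : k) ≠ 0) {q q' : QuadraticForm k (Fin 3 → k)} {c : k}
    (hc : c ≠ 0) (f : (Fin 3 → k) ≃ₗ[k] (Fin 3 → k)) (hf : ∀ v, q' (f v) = c * q v)
    {x : Fin 3 → E} (hx : IsGenericZero q x) :
    IsGenericZero q' (extendLin f.toLinearMap E x) := by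
  intro p
  constructor
  · intro hp
    have h := (hx (aeval (extendLin f.toLinearMap _ X) p)).mp (by
      rw [← hp, ← AlgHom.comp_apply, comp_aeval]
      congr 2
      ext1 i
      simp [map_extendLin])
    have h' := map_dvd (aeval (extendLin f.symm.toLinearMap (MvPolynomial (Fin 3) k) X) :
      MvPolynomial (Fin 3) k →ₐ[k] _) h
    have hid : aeval (extendLin f.symm.toLinearMap (MvPolynomial (Fin 3) k) X)
        (aeval (extendLin f.toLinearMap (MvPolynomial (Fin 3) k) X) p) = p := by
      rw [← AlgHom.comp_apply, comp_aeval]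
      have : (fun i => aeval (extendLin f.symm.toLinearMap (MvPolynomial (Fin 3) k) X)
          (extendLin f.toLinearMap (MvPolynomial (Fin 3) k) X i)) = X := by
        ext1 i
        rw [map_extendLin]
        simp only [aeval_X]
        rw [← extendLin_comp, LinearEquiv.comp_symm, extendLin_id]
      rw [this, aeval_X_left_apply]
    have hsymm (v : Fin 3 → k) : q (f.symm.toLinearMap v) = c⁻¹ * q' v := by
      have := hf (f.symm v)
      rw [f.apply_symm_apply] at this
      rw [this, inv_mul_cancel_left₀ hc]
      rfl
    rw [hid, aeval_quadricPoly, extendQF_extendLin h2 hsymm] at h'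
    exact (dvd_mul_left _ _).trans h'
  · rintro ⟨r, rfl⟩
    have h0 := (hx _).mpr dvd_rfl
    rw [aeval_quadricPoly] at h0
    rw [map_mul, aeval_quadricPoly, extendQF_extendLin h2 hf, h0, mul_zero, zero_mul]

theorem exists_homogenization {x : Fin 3 → E} (hx : x 2 ≠ 0) (f : MvPolynomial (Fin (3 - 1)) k) :
    ∃ (F : MvPolynomial (Fin 3) k) (d : ℕ),
      aeval (![X 0, X 1, 1] : Fin 3 → MvPolynomial (Fin (3 - 1)) k) F = f ∧
      aeval x F = x 2 ^ d * aeval (![x 0 / x 2, x 1 / x 2] : Fin (3 - 1) → E) f := by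
  induction f using MvPolynomial.induction_on with
  | C a => exact ⟨C a, 0, by simp, by simp⟩
  | add p q hp hq =>
    obtain ⟨P, d, hP, hP'⟩ := hp
    obtain ⟨Q, e, hQ, hQ'⟩ := hq
    refine ⟨X 2 ^ e * P + X 2 ^ d * Q, d + e, ?_, ?_⟩
    · simp only [map_add, map_mul, map_pow, aeval_X, hP, hQ]
      simp
    simp only [map_add, map_mul, map_pow, aeval_X, hP', hQ']
    ring
  | mul_X p i hp =>
    obtain ⟨P, d, hP, hP'⟩ := hp
    refine ⟨P * X (Fin.castSucc i), d + 1, ?_, ?_⟩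
    · rw [map_mul, hP, aeval_X]
      fin_cases i <;> rfl
    · rw [map_mul, hP', map_mul, aeval_X, aeval_X]
      fin_cases i <;> simp <;> field_simp <;> ring

theorem IsGenericZero.aeval_div_eq_zero_iff (h2 : (2 : k) ≠ 0) {q : QuadraticForm k (Fin 3 → k)}
    (hq : NondegQF q) {x : Fin 3 → E} (hx : IsGenericZero q x)
    (f : MvPolynomial (Fin (3 - 1)) k) :
    aeval (![x 0 / x 2, x 1 / x 2] : Fin (3 - 1) → E) f = 0 ↔ affineQuadricPoly q ∣ f := by
  have hx2 := hx.coord_ne_zero h2 hq 2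
  constructor
  · intro hf
    obtain ⟨F, d, hF, hF'⟩ := exists_homogenization hx2 f
    rw [hf, mul_zero] at hF'
    rw [affineQuadricPoly_eq, ← hF]
    exact map_dvd _ ((hx F).mp hF')
  · rintro ⟨r, rfl⟩
    rw [map_mul]
    have h0 := (hx _).mpr dvd_rfl
    have h1 : aeval (![x 0 / x 2, x 1 / x 2] : Fin (3 - 1) → E) (affineQuadricPoly q)
        = (x 2)⁻¹ ^ 2 * aeval x (quadricPoly q) := by
      rw [affineQuadricPoly_eq, aeval_quadricPoly, aeval_quadricPoly, map_extendQF, pow_two,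
        ← smul_eq_mul _ (extendQF q E x), ← QuadraticMap.map_smul]
      congr 1
      ext1 i
      fin_cases i <;> simp [hx2] <;> field_simp
    rw [h1, h0, mul_zero, zero_mul]

theorem IsGenericZero.nonempty_algEquiv (h2 : (2 : k) ≠ 0) {q : QuadraticForm k (Fin 3 → k)}
    (hq : NondegQF q) {x : Fin 3 → E} (hx : IsGenericZero q x) :
    Nonempty (quadricFunctionField q ≃ₐ[k]
      IntermediateField.adjoin k (Set.range (![x 0 / x 2, x 1 / x 2] : Fin (3 - 1) → E))) := by
  set z : Fin (3 - 1) → E := ![x 0 / x 2, x 1 / x 2] with hz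
  have hker : Ideal.span {affineQuadricPoly q} = RingHom.ker (aeval z : _ →ₐ[k] E) := by
    ext f
    rw [Ideal.mem_span_singleton, RingHom.mem_ker, ← hx.aeval_div_eq_zero_iff h2 hq]
  let e₁ : quadricCoordRing q ≃ₐ[k] Algebra.adjoin k (Set.range z) :=
    (Ideal.quotientEquivAlgOfEq k hker).trans <|
      (Ideal.quotientKerEquivRange (aeval z : MvPolynomial (Fin (3 - 1)) k →ₐ[k] E)).trans <|
        Subalgebra.equivOfEq _ _ (Algebra.adjoin_range_eq_range_aeval k z).symm
  exact ⟨IsFractionRing.algEquivOfAlgEquiv e₁⟩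

theorem adjoin_div_extendLin_le (f : (Fin 3 → k) →ₗ[k] (Fin 3 → k)) {x : Fin 3 → E}
    (hx : x 2 ≠ 0) :
    IntermediateField.adjoin k (Set.range (![extendLin f E x 0 / extendLin f E x 2,
      extendLin f E x 1 / extendLin f E x 2] : Fin (3 - 1) → E)) ≤
    IntermediateField.adjoin k (Set.range (![x 0 / x 2, x 1 / x 2] : Fin (3 - 1) → E)) := by
  set L := IntermediateField.adjoin k (Set.range (![x 0 / x 2, x 1 / x 2] : Fin (3 - 1) → E))
  have hxL (j : Fin 3) : x j / x 2 ∈ L := by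
    fin_cases j
    · exact IntermediateField.subset_adjoin k _ ⟨(0 : Fin 2), rfl⟩
    · exact IntermediateField.subset_adjoin k _ ⟨(1 : Fin 2), rfl⟩
    · simp [hx, L.one_mem]
  have hyL (j : Fin 3) : extendLin f E x j / x 2 ∈ L := by
    rw [extendLin, Finset.sum_div]
    refine L.sum_mem fun i _ => ?_
    rw [mul_div_assoc]
    exact L.mul_mem (L.algebraMap_mem _) (hxL i)
  have hy (j : Fin 3) : extendLin f E x j / extendLin f E x 2 ∈ L := by
    rw [← div_div_div_cancel_right₀ hx]
    exact L.div_mem (hyL j) (hyL 2)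
  rw [IntermediateField.adjoin_le_iff]
  rintro _ ⟨i, rfl⟩
  fin_cases i
  · exact hy 0
  · exact hy 1

theorem nonempty_algEquiv_of_similarQF {q q' : QuadraticForm k (Fin 3 → k)} (h2 : (2 : k) ≠ 0)
    (hq : NondegQF q) (hq' : NondegQF q') (h : SimilarQF q q') :
    Nonempty (quadricFunctionField q ≃ₐ[k] quadricFunctionField q') := by
  obtain ⟨c, hc, f, hf⟩ := h.exists_linearEquiv
  obtain ⟨E, _, _, x, hx⟩ := exists_isGenericZero h2 hq
  have hy := hx.baseChangeLin h2 hc f hf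
  obtain ⟨e⟩ := hx.nonempty_algEquiv h2 hq
  obtain ⟨e'⟩ := hy.nonempty_algEquiv h2 hq'
  refine ⟨e.trans ((IntermediateField.equivOfEq (le_antisymm ?_ ?_)).trans e'.symm)⟩
  · have h := adjoin_div_extendLin_le f.symm.toLinearMap (hy.coord_ne_zero h2 hq' 2)
    rwa [← extendLin_comp, LinearEquiv.symm_comp, extendLin_id] at h
  · exact adjoin_div_extendLin_le f.toLinearMap (hx.coord_ne_zero h2 hq 2)

end GenericZero

section Diagonal

variable {k : Type*} [Field k]

/-- The diagonal quadratic form with coefficients `w`. -/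
abbrev diagQF (w : Fin 3 → k) : QuadraticForm k (Fin 3 → k) :=
  QuadraticMap.weightedSumSquares k w

theorem diagQF_apply (w v : Fin 3 → k) : diagQF w v = ∑ i, w i * v i ^ 2 := by
  simp [QuadraticMap.weightedSumSquares_apply, pow_two]

theorem polar_diagQF_single (w : Fin 3 → k) (i j : Fin 3) :
    QuadraticMap.polar (diagQF w) (Pi.single i 1) (Pi.single j 1) =
      if i = j then 2 * w i else 0 := by
  simp only [QuadraticMap.polar, diagQF_apply, Fin.sum_univ_three]
  fin_cases i <;> fin_cases j <;> simp <;> ring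

theorem nondegQF_diagQF (h2 : (2 : k) ≠ 0) {w : Fin 3 → k} (hw : ∀ i, w i ≠ 0) :
    NondegQF (diagQF w) := by
  have h : polarMatrix (diagQF w) = Matrix.diagonal fun i => 2 * w i := by
    ext i j
    rw [polarMatrix, Matrix.of_apply, polar_diagQF_single, Matrix.diagonal_apply]
  rw [NondegQF, discQF, h, Matrix.det_diagonal]
  exact Finset.prod_ne_zero_iff.mpr fun i _ => mul_ne_zero h2 (hw i)

theorem extendQF_diagQF (w : Fin 3 → k) (A : Type*) [CommRing A] [Algebra k A] (v : Fin 3 → A) :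
    extendQF (diagQF w) A v = ∑ i, algebraMap k A (w i) * v i ^ 2 := by
  have h : coeffMatrix (diagQF w) = Matrix.diagonal w := by
    ext i j
    rw [coeffMatrix, Matrix.of_apply, polar_diagQF_single, Matrix.diagonal_apply]
    by_cases hij : i = j
    · simp [hij, Pi.single_apply]
    · simp [hij]
  rw [extendQF_apply, h]
  refine Finset.sum_congr rfl fun i _ => ?_
  rw [Finset.sum_eq_single i]
  · rw [Matrix.diagonal_apply_eq]
    ring
  · intro j _ hj
    simp [Matrix.diagonal_apply_ne' w hj]
  · simp

theorem exists_similarQF_diagQF (h2 : (2 : k) ≠ 0) {q : QuadraticForm k (Fin 3 → k)}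
    (hq : NondegQF q) : ∃ w : Fin 3 → k, (∀ i, w i ≠ 0) ∧ SimilarQF q (diagQF w) := by
  have : Invertible (2 : k) := invertibleOfNonzero h2
  have hsep : (QuadraticMap.associated (R := k) q).SeparatingLeft := by
    intro v hv
    refine Matrix.eq_zero_of_mulVec_eq_zero hq (funext fun i => ?_)
    have h := hv (Pi.single i 1)
    rw [QuadraticMap.associated_apply, ← QuadraticMap.polar] at h
    have h' : QuadraticMap.polar q v (Pi.single i 1) = 0 := by
      simpa [h2] using h
    rw [QuadraticMap.polar_comm, polar_eq_sum] at h'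
    simpa [Matrix.mulVec, dotProduct, Pi.single_apply] using h'
  obtain ⟨w, ⟨e⟩⟩ := q.equivalent_weightedSumSquares_units_of_nondegenerate' hsep
  have h3 : Module.finrank k (Fin 3 → k) = 3 := by simp
  revert w
  rw [h3]
  intro w e
  refine ⟨fun i => w i, fun i => (w i).ne_zero,
    similarQF_of_linearMap hq one_ne_zero e.toLinearEquiv.toLinearMap fun v => ?_⟩
  have := e.map_app v
  rw [one_mul, ← this, diagQF_apply, QuadraticMap.weightedSumSquares_apply]
  refine Finset.sum_congr rfl fun i _ => ?_
  rw [Units.smul_def, smul_eq_mul, pow_two]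
  rfl

theorem exists_similarQF_diagQF_neg_one (h2 : (2 : k) ≠ 0) {q : QuadraticForm k (Fin 3 → k)}
    (hq : NondegQF q) : ∃ a b : k, a ≠ 0 ∧ b ≠ 0 ∧ SimilarQF q (diagQF ![a, -1, b]) := by
  obtain ⟨w, hw, h⟩ := exists_similarQF_diagQF h2 hq
  refine ⟨-w 0 / w 1, -w 2 / w 1, div_ne_zero (neg_ne_zero.mpr (hw 0)) (hw 1),
    div_ne_zero (neg_ne_zero.mpr (hw 2)) (hw 1), h.trans hq ?_⟩
  refine similarQF_of_linearMap (nondegQF_diagQF h2 hw)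
    (inv_ne_zero (neg_ne_zero.mpr (hw 1))) LinearMap.id fun v => ?_
  have := hw 1
  simp only [diagQF_apply, Fin.sum_univ_three, LinearMap.id_apply, Matrix.cons_val]
  field_simp
  ring

/-- The coefficients of the negative of the adjugate of the diagonal form with coefficients `w`. -/
def negAdjugate (w : Fin 3 → k) : Fin 3 → k :=
  ![-(w 1 * w 2), -(w 0 * w 2), -(w 0 * w 1)]

theorem similarQF_diagQF_of_orthogonal (h2 : (2 : k) ≠ 0) {w : Fin 3 → k} (hw : ∀ i, w i ≠ 0)
    {a b : k} (ha : a ≠ 0) (hb : b ≠ 0) {s t : Fin 3 → k}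
    (hs : ∑ i, negAdjugate w i * s i ^ 2 = b) (ht : ∑ i, negAdjugate w i * t i ^ 2 = a)
    (hst : ∑ i, negAdjugate w i * s i * t i = 0) :
    SimilarQF (diagQF ![a, -1, b]) (diagQF w) := by
  have hw' : w 0 * w 1 * w 2 ≠ 0 := mul_ne_zero (mul_ne_zero (hw 0) (hw 1)) (hw 2)
  refine similarQF_of_linearMap (nondegQF_diagQF h2 ?_) (c := -(a * b * (w 0 * w 1 * w 2)))
    (neg_ne_zero.mpr (mul_ne_zero (mul_ne_zero ha hb) hw'))
    (Fintype.linearCombination k ![fun i => -(a * negAdjugate w i * s i),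
      (w 0 * w 1 * w 2) • crossProduct s t, fun i => -(b * negAdjugate w i * t i)]) fun v => ?_
  · intro i
    fin_cases i <;> simp [ha, hb]
  · simp only [negAdjugate, Fin.sum_univ_three, Matrix.cons_val] at hs ht hst
    simp only [diagQF_apply, Fintype.linearCombination_apply, Fin.sum_univ_three, Matrix.cons_val,
      Pi.add_apply, Pi.smul_apply, smul_eq_mul, negAdjugate, cross_apply]
    linear_combination
      (-(w 0 * w 1 * w 2) * a ^ 2 * v 0 ^ 2 + (w 0 * w 1 * w 2) * v 1 ^ 2 * a) * hs +
      (-(w 0 * w 1 * w 2) * b ^ 2 * v 2 ^ 2 + (w 0 * w 1 * w 2) * v 1 ^ 2 *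
        (-(w 1 * w 2) * s 0 ^ 2 + -(w 0 * w 2) * s 1 ^ 2 + -(w 0 * w 1) * s 2 ^ 2)) * ht +
      (-2 * a * b * (w 0 * w 1 * w 2) * v 0 * v 2 - (w 0 * w 1 * w 2) * v 1 ^ 2 *
        (-(w 1 * w 2) * s 0 * t 0 + -(w 0 * w 2) * s 1 * t 1 + -(w 0 * w 1) * s 2 * t 2)) * hst

theorem similarQF_diagQF_of_isotropic (h2 : (2 : k) ≠ 0) {w : Fin 3 → k} (hw : ∀ i, w i ≠ 0)
    {v : Fin 3 → k} (hv : v ≠ 0) (hv0 : diagQF w v = 0) :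
    SimilarQF (diagQF ![-1, -1, 1]) (diagQF w) := by
  have hn (i : Fin 3) : negAdjugate w i ≠ 0 := by
    fin_cases i <;> simp [negAdjugate, hw]
  obtain ⟨p, hp, hp0⟩ : ∃ p : Fin 3 → k, p ≠ 0 ∧ ∑ i, negAdjugate w i * p i ^ 2 = 0 := by
    refine ⟨fun i => w i * v i, fun h => hv (funext fun i => ?_), ?_⟩
    · exact (mul_eq_zero.mp (congrFun h i)).resolve_left (hw i)
    · simp only [diagQF_apply, Fin.sum_univ_three] at hv0
      simp only [negAdjugate, Fin.sum_univ_three, Matrix.cons_val]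
      linear_combination -(w 0 * w 1 * w 2) * hv0
  obtain ⟨r, hr⟩ : ∃ r : Fin 3 → k, 2 * ∑ i, negAdjugate w i * p i * r i = 1 := by
    obtain ⟨i, hi⟩ := Function.ne_iff.mp hp
    refine ⟨Pi.single i (2 * negAdjugate w i * p i)⁻¹, ?_⟩
    have := hn i
    have hi' : p i ≠ 0 := hi
    simp [Pi.single_apply]
    field_simp
  obtain ⟨m, hm⟩ : ∃ m, m = ∑ i, negAdjugate w i * r i ^ 2 := ⟨_, rfl⟩
  refine similarQF_diagQF_of_orthogonal h2 hw (neg_ne_zero.mpr one_ne_zero) one_ne_zero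
    (s := fun i => p i + (r i - m * p i)) (t := fun i => p i - (r i - m * p i)) ?_ ?_ ?_
  all_goals
    simp only [Fin.sum_univ_three] at *
  · linear_combination (1 - m) * (1 - m) * hp0 + (1 - m) * hr - hm
  · linear_combination (1 + m) * (1 + m) * hp0 - (1 + m) * hr - hm
  · linear_combination (1 - m) * (1 + m) * hp0 + m * hr + hm

end Diagonal

section CasselsPfister

open Polynomial

variable {k : Type*} [Field k]

theorem two_mul_natDegree_le_of_anisotropic {w : Fin 3 → k}
    (hw : ∀ v : Fin 3 → k, ∑ i, w i * v i ^ 2 = 0 → v = 0) (s : Fin 3 → k[X]) (i : Fin 3) :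
    2 * (s i).natDegree ≤ (∑ j, C (w j) * s j ^ 2).natDegree := by
  obtain ⟨m, -, hm⟩ := Finset.exists_max_image Finset.univ (fun j => (s j).natDegree)
    Finset.univ_nonempty
  refine (Nat.mul_le_mul_left 2 (hm i (Finset.mem_univ i))).trans ?_
  by_cases h0 : (s m).natDegree = 0
  · simp [h0]
  have hc : (∑ j, C (w j) * s j ^ 2).coeff (2 * (s m).natDegree) =
      ∑ j, w j * (s j).coeff (s m).natDegree ^ 2 := by
    rw [finsetSum_coeff]
    refine Finset.sum_congr rfl fun j _ => ?_
    rw [coeff_C_mul, coeff_pow_of_natDegree_le (hm j (Finset.mem_univ j))]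
  refine le_natDegree_of_ne_zero fun h => h0 ?_
  have h' := congrFun (hw (fun j => (s j).coeff (s m).natDegree) (hc.symm.trans h)) m
  rw [leadingCoeff_eq_zero.mp h', natDegree_zero]

theorem eq_zero_of_anisotropic {w : Fin 3 → k}
    (hw : ∀ v : Fin 3 → k, ∑ i, w i * v i ^ 2 = 0 → v = 0) {s : Fin 3 → k[X]}
    (hs : ∑ i, C (w i) * s i ^ 2 = 0) : s = 0 := by
  have hd (i : Fin 3) : s i = C ((s i).coeff 0) := by
    have := two_mul_natDegree_le_of_anisotropic hw s i
    rw [hs, natDegree_zero] at this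
    exact eq_C_of_natDegree_eq_zero (by omega)
  have h0 := hw (fun i => (s i).coeff 0) (C_injective (by
    rw [C_0, ← hs, map_sum]
    refine Finset.sum_congr rfl fun i _ => ?_
    conv_rhs => rw [hd i]
    simp))
  funext i
  rw [hd i]
  simpa using congrFun h0 i

/-- A polynomial represented over `k(X)` by an anisotropic diagonal form with constant coefficients
is represented over `k[X]`. -/
theorem exists_sum_eq_of_sum_eq_sq_mul {w : Fin 3 → k}
    (hw : ∀ v : Fin 3 → k, ∑ i, w i * v i ^ 2 = 0 → v = 0) {f t : k[X]} (ht : t ≠ 0)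
    {s : Fin 3 → k[X]} (hs : ∑ i, C (w i) * s i ^ 2 = t ^ 2 * f) :
    ∃ s' : Fin 3 → k[X], ∑ i, C (w i) * s' i ^ 2 = f := by
  induction hn : t.natDegree using Nat.strong_induction_on generalizing t s with
  | _ n ih =>
  obtain ⟨r, hr⟩ : ∃ r : Fin 3 → k[X], ∀ i, r i = s i / t := ⟨_, fun _ => rfl⟩
  obtain ⟨m, hm⟩ : ∃ m : Fin 3 → k[X], ∀ i, m i = s i % t := ⟨_, fun _ => rfl⟩
  have hsm (i : Fin 3) : s i = t * r i + m i := by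
    rw [hr, hm, EuclideanDomain.div_add_mod]
  by_cases hm0 : m = 0
  · refine ⟨r, mul_left_cancel₀ (pow_ne_zero 2 ht) (hs ▸ ?_)⟩
    rw [Finset.mul_sum]
    refine Finset.sum_congr rfl fun i _ => ?_
    rw [hsm, hm0, Pi.zero_apply]
    ring
  set b : k[X] := 2 * ∑ i, C (w i) * s i * r i with hb
  set R : k[X] := ∑ i, C (w i) * r i ^ 2 with hR
  have hφm : ∑ i, C (w i) * m i ^ 2 = t * (t * f - b + t * R) := by
    have hm' (i : Fin 3) : m i = s i - t * r i := by
      rw [hsm]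
      ring
    simp only [hm', hb, hR, Fin.sum_univ_three] at hs ⊢
    linear_combination hs
  have hne : t * f - b + t * R ≠ 0 := by
    intro h
    rw [h, mul_zero] at hφm
    exact hm0 (eq_zero_of_anisotropic hw hφm)
  have hdeg : ∀ i, (m i).natDegree + 1 ≤ t.natDegree := by
    have htpos : t.natDegree ≠ 0 := by
      intro h
      apply hm0
      funext i
      rw [hm, EuclideanDomain.mod_eq_zero.mpr]
      · rfl
      · rw [eq_C_of_natDegree_eq_zero h] at ht ⊢
        exact (isUnit_C.mpr (IsUnit.mk0 _ (C_ne_zero.mp ht))).dvd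
    intro i
    rw [hm]
    exact natDegree_mod_lt _ htpos
  have hlt : (t * f - b + t * R).natDegree < n := by
    have hle : (∑ i, C (w i) * m i ^ 2).natDegree ≤ 2 * (t.natDegree - 1) := by
      refine natDegree_sum_le_of_forall_le _ _ fun i _ => ?_
      refine (natDegree_C_mul_le _ _).trans (natDegree_pow_le.trans ?_)
      have := hdeg i
      omega
    rw [hφm, natDegree_mul ht hne] at hle
    have := hdeg 0
    omega
  refine ih _ hlt hne (s := fun i => (R - f) * s i + (2 * f * t - b) * r i) ?_ rfl
  simp only [Fin.sum_univ_three] at hs hb hR ⊢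
  linear_combination (R - f) ^ 2 * hs - (R - f) * (2 * f * t - b) * hb -
    (2 * f * t - b) ^ 2 * hR

end CasselsPfister

section ConicPoint

open Polynomial

variable {k : Type*} [Field k]

theorem affineQuadricPoly_diagQF (w : Fin 3 → k) :
    affineQuadricPoly (diagQF w) = MvPolynomial.C (w 0) * MvPolynomial.X 0 ^ 2 +
      MvPolynomial.C (w 1) * MvPolynomial.X 1 ^ 2 + MvPolynomial.C (w 2) := by
  rw [affineQuadricPoly_eq, aeval_quadricPoly, extendQF_diagQF, Fin.sum_univ_three]
  simp [MvPolynomial.algebraMap_eq]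

/-- The ring `k[x][√(ax² + b)]`. -/
abbrev SqrtAlgebra (a b : k) : Type _ :=
  QuadraticAlgebra k[X] (C a * X ^ 2 + C b) 0

/-- The affine coordinate ring of the conic `y² = ax² + b` embeds into `k[x][√(ax² + b)]`. -/
theorem exists_injective_algHom_quadraticAlgebra (a b : k) :
    ∃ ψ : quadricCoordRing (diagQF ![a, -1, b]) →ₐ[k]
      SqrtAlgebra a b, Function.Injective ψ := by
  let z : Fin (3 - 1) → (SqrtAlgebra a b) := ![algebraMap k[X] (SqrtAlgebra a b) X, ⟨0, 1⟩]
  have hz0 : z 0 = algebraMap k[X] (SqrtAlgebra a b) X := rfl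
  have hz1 : z 1 = ⟨0, 1⟩ := rfl
  have hC (r : k) :
      algebraMap k (SqrtAlgebra a b) r = algebraMap k[X] (SqrtAlgebra a b) (C r) := rfl
  have hz : MvPolynomial.aeval z (affineQuadricPoly (diagQF ![a, -1, b])) = 0 := by
    rw [affineQuadricPoly_diagQF]
    simp only [map_add, map_mul, map_pow, MvPolynomial.aeval_X, MvPolynomial.aeval_C,
      Matrix.cons_val, hz0, hz1, hC]
    ext : 1 <;> simp [pow_two]
  let ψ : quadricCoordRing (diagQF ![a, -1, b]) →ₐ[k] SqrtAlgebra a b :=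
    Ideal.Quotient.liftₐ _ (MvPolynomial.aeval z) fun f hf => by
      obtain ⟨g, rfl⟩ := Ideal.mem_span_singleton.mp hf
      rw [map_mul, hz, zero_mul]
  let mk : MvPolynomial (Fin (3 - 1)) k →ₐ[k] quadricCoordRing (diagQF ![a, -1, b]) :=
    Ideal.Quotient.mkₐ k _
  have hψ (f) : ψ (mk f) = MvPolynomial.aeval z f := rfl
  let x := mk (MvPolynomial.X 0)
  let y := mk (MvPolynomial.X 1)
  have hy : y ^ 2 = aeval x (C a * X ^ 2 + C b) := by
    have h : mk (affineQuadricPoly (diagQF ![a, -1, b])) = 0 :=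
      Ideal.Quotient.eq_zero_iff_mem.mpr (Ideal.mem_span_singleton_self _)
    replace h := (congrArg mk (affineQuadricPoly_diagQF ![a, -1, b])).symm.trans h
    simp only [map_add, map_mul, map_pow, Matrix.cons_val, map_neg, map_one] at h
    simp only [map_add, map_mul, map_pow, aeval_X, aeval_C]
    have hC' (r : k) : mk (MvPolynomial.C r) = algebraMap k _ r := mk.commutes r
    rw [hC', hC'] at h
    linear_combination -h
  have hnf (f : MvPolynomial (Fin (3 - 1)) k) : ∃ u v : k[X], mk f = aeval x u + aeval x v * y := by
    induction f using MvPolynomial.induction_on with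
    | C r => exact ⟨C r, 0, by simp⟩
    | add p q hp hq =>
      obtain ⟨u, v, h⟩ := hp
      obtain ⟨u', v', h'⟩ := hq
      refine ⟨u + u', v + v', ?_⟩
      rw [map_add, h, h', map_add, map_add]
      ring
    | mul_X p i hp =>
      obtain ⟨u, v, h⟩ := hp
      rw [map_mul, h]
      fin_cases i
      · refine ⟨u * X, v * X, ?_⟩
        change _ * x = _
        simp only [map_mul, aeval_X]
        ring
      · refine ⟨v * (C a * X ^ 2 + C b), u, ?_⟩
        change _ * y = _
        rw [map_mul, ← hy]
        ring
  refine ⟨ψ, (injective_iff_map_eq_zero ψ).mpr fun p hp => ?_⟩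
  obtain ⟨f, rfl⟩ := Ideal.Quotient.mk_surjective p
  obtain ⟨u, v, h⟩ := hnf f
  change mk f = 0
  change ψ (mk f) = 0 at hp
  have hx (u : k[X]) : ψ (aeval x u) = algebraMap k[X] (SqrtAlgebra a b) u := by
    rw [← aeval_algHom_apply, hψ, MvPolynomial.aeval_X, hz0]
    rw [aeval_algebraMap_apply, aeval_X_left_apply]
  rw [h, map_add, map_mul, hx, hx, hψ, MvPolynomial.aeval_X, hz1] at hp
  have hu : u = 0 := by simpa using congrArg QuadraticAlgebra.re hp
  have hv : v = 0 := by simpa using congrArg QuadraticAlgebra.im hp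
  rw [h, hu, hv]
  simp

/-- A nontrivial zero of a diagonal form in the function field of the conic `y² = ax² + b` yields
a nontrivial zero with coordinates in `k[x] + k[x]√(ax² + b)`. -/
theorem exists_polynomial_zero_of_functionField (h2 : (2 : k) ≠ 0) {a b : k} {w : Fin 3 → k}
    {v : Fin 3 → quadricFunctionField (diagQF ![a, -1, b])} (hv : v ≠ 0)
    (hv0 : extendQF (diagQF w) _ v = 0) :
    ∃ u r : Fin 3 → k[X], (u ≠ 0 ∨ r ≠ 0) ∧
      ∑ i, C (w i) * (u i ^ 2 + (C a * X ^ 2 + C b) * r i ^ 2) = 0 ∧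
      ∑ i, C (w i) * u i * r i = 0 := by
  obtain ⟨ψ, hψ⟩ := exists_injective_algHom_quadraticAlgebra a b
  obtain ⟨c, hc⟩ := IsLocalization.exist_integer_multiples_of_finite
    (nonZeroDivisors (quadricCoordRing (diagQF ![a, -1, b]))) v
  choose p hp using hc
  have hsum : ∑ i, algebraMap k _ (w i) * p i ^ 2 = 0 := by
    apply IsFractionRing.injective _ (quadricFunctionField (diagQF ![a, -1, b]))
    rw [extendQF_diagQF] at hv0
    rw [map_zero, map_sum]
    refine Eq.trans ?_ ((congrArg
      (algebraMap _ _ (c : quadricCoordRing (diagQF ![a, -1, b])) ^ 2 * ·) hv0).trans (mul_zero _))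
    rw [Finset.mul_sum]
    refine Finset.sum_congr rfl fun i _ => ?_
    rw [map_mul, map_pow, hp, Algebra.smul_def, ← IsScalarTower.algebraMap_apply]
    ring
  have hψsum := congrArg ψ hsum
  simp only [map_sum, map_mul, map_pow, map_zero, AlgHom.commutes] at hψsum
  have hC (r : k) : algebraMap k (SqrtAlgebra a b) r =
    ⟨C r, 0⟩ := rfl
  refine ⟨fun i => (ψ (p i)).re, fun i => (ψ (p i)).im, ?_, ?_, ?_⟩
  · by_contra! h
    apply hv
    funext i
    have h0 : p i = 0 := by
      apply hψ
      rw [map_zero]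
      exact QuadraticAlgebra.ext (congrFun h.1 i) (congrFun h.2 i)
    have := hp i
    rw [h0, map_zero, Algebra.smul_def] at this
    exact ((IsLocalization.map_units _ c).mul_right_eq_zero.mp this.symm)
  · have := congrArg QuadraticAlgebra.re hψsum
    simp only [Fin.sum_univ_three, hC, pow_two] at this ⊢
    simp at this
    linear_combination this
  · have := congrArg QuadraticAlgebra.im hψsum
    have h2' : (2 : k[X]) ≠ 0 := by
      rw [← C_ofNat]
      exact C_ne_zero.mpr h2
    apply mul_left_cancel₀ h2'
    simp only [Fin.sum_univ_three, hC, pow_two] at this ⊢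
    simp at this
    linear_combination this

end ConicPoint

section ConicFunctionField

open Polynomial

variable {k : Type*} [Field k]

theorem negAdjugate_anisotropic {w : Fin 3 → k} (hw : ∀ i, w i ≠ 0)
    (haniso : ∀ v : Fin 3 → k, ∑ i, w i * v i ^ 2 = 0 → v = 0) (s : Fin 3 → k)
    (hs : ∑ i, negAdjugate w i * s i ^ 2 = 0) : s = 0 := by
  have h := haniso (fun i => negAdjugate w i * s i) (by
    simp only [negAdjugate, Fin.sum_univ_three, Matrix.cons_val] at hs ⊢
    linear_combination -(w 0 * w 1 * w 2) * hs)
  funext i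
  refine (mul_eq_zero.mp (congrFun h i)).resolve_left ?_
  fin_cases i <;> simp [negAdjugate, hw]

theorem similarQF_diagQF_of_functionField (h2 : (2 : k) ≠ 0) {w : Fin 3 → k} (hw : ∀ i, w i ≠ 0)
    (haniso : ∀ v : Fin 3 → k, ∑ i, w i * v i ^ 2 = 0 → v = 0) {a b : k} (ha : a ≠ 0) (hb : b ≠ 0)
    {v : Fin 3 → quadricFunctionField (diagQF ![a, -1, b])} (hv : v ≠ 0)
    (hv0 : extendQF (diagQF w) _ v = 0) : SimilarQF (diagQF ![a, -1, b]) (diagQF w) := by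
  obtain ⟨u, r, hne, hsq, horth⟩ := exists_polynomial_zero_of_functionField h2 hv hv0
  have ht : ∑ i, C (w i) * r i ^ 2 ≠ 0 := by
    intro ht
    have hr := eq_zero_of_anisotropic haniso ht
    have hu : u = 0 := eq_zero_of_anisotropic haniso (by simpa [hr] using hsq)
    exact hne.elim (· hu) (· hr)
  obtain ⟨p, hp⟩ := exists_sum_eq_of_sum_eq_sq_mul (negAdjugate_anisotropic hw haniso) ht
    (f := C a * X ^ 2 + C b) (s := crossProduct u r) (by
      simp only [Fin.sum_univ_three, cross_apply, negAdjugate, Matrix.cons_val, C_neg, C_mul]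
        at hsq horth ⊢
      linear_combination -(C (w 0) * r 0 ^ 2 + C (w 1) * r 1 ^ 2 + C (w 2) * r 2 ^ 2) * hsq +
        (C (w 0) * u 0 * r 0 + C (w 1) * u 1 * r 1 + C (w 2) * u 2 * r 2) * horth)
  have hdeg (i : Fin 3) : (p i).natDegree ≤ 1 := by
    have h := two_mul_natDegree_le_of_anisotropic (negAdjugate_anisotropic hw haniso) p i
    rw [hp] at h
    have h' : (C a * X ^ 2 + C b).natDegree ≤ 2 := by compute_degree
    omega
  have hlin (i : Fin 3) : p i = C ((p i).coeff 1) * X + C ((p i).coeff 0) :=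
    eq_X_add_C_of_natDegree_le_one (hdeg i)
  obtain ⟨t, htp⟩ : ∃ t : Fin 3 → k, ∀ i, t i = (p i).coeff 1 := ⟨_, fun _ => rfl⟩
  obtain ⟨s, hsp⟩ : ∃ s : Fin 3 → k, ∀ i, s i = (p i).coeff 0 := ⟨_, fun _ => rfl⟩
  have hpoly : C (∑ i, negAdjugate w i * t i ^ 2) * X ^ 2 +
      C (2 * ∑ i, negAdjugate w i * s i * t i) * X + C (∑ i, negAdjugate w i * s i ^ 2) =
      C a * X ^ 2 + C b := by
    rw [← hp]
    simp_rw [← htp, ← hsp] at hlin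
    simp only [Fin.sum_univ_three, hlin, C_add, C_mul, C_pow, C_ofNat]
    ring
  have hcoeff {A B D : k} (h : C A * X ^ 2 + C B * X + C D = C a * X ^ 2 + C b) :
      D = b ∧ A = a ∧ B = 0 :=
    ⟨by simpa using congrArg (coeff · 0) h,
      by simpa [coeff_X, coeff_C] using congrArg (coeff · 2) h,
      by simpa [coeff_X, coeff_C] using congrArg (coeff · 1) h⟩
  obtain ⟨hs, ht, hst⟩ := hcoeff hpoly
  exact similarQF_diagQF_of_orthogonal h2 hw ha hb hs ht ((mul_eq_zero.mp hst).resolve_left h2)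

theorem exists_zero_functionField (q : QuadraticForm k (Fin 3 → k)) :
    ∃ v : Fin 3 → quadricFunctionField q, v 2 = 1 ∧ extendQF q _ v = 0 := by
  let g : MvPolynomial (Fin (3 - 1)) k →ₐ[k] quadricFunctionField q :=
    (IsScalarTower.toAlgHom k (quadricCoordRing q) _).comp (Ideal.Quotient.mkₐ k _)
  refine ⟨fun i => g (![MvPolynomial.X 0, MvPolynomial.X 1, 1] i), map_one g, ?_⟩
  rw [← map_extendQF, ← aeval_quadricPoly, ← affineQuadricPoly_eq]
  change algebraMap (quadricCoordRing q) _ (Ideal.Quotient.mk _ (affineQuadricPoly q)) = 0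
  rw [Ideal.Quotient.eq_zero_iff_mem.mpr (Ideal.mem_span_singleton_self _), map_zero]

theorem similarQF_of_algEquiv_of_anisotropic (h2 : (2 : k) ≠ 0) {q q' : QuadraticForm k (Fin 3 → k)}
    (hq : NondegQF q) (hq' : NondegQF q') (haniso : ∀ v, q' v = 0 → v = 0)
    (e : quadricFunctionField q ≃ₐ[k] quadricFunctionField q') : SimilarQF q q' := by
  obtain ⟨a, b, ha, hb, hqd⟩ := exists_similarQF_diagQF_neg_one h2 hq
  obtain ⟨w, hw, hqw⟩ := exists_similarQF_diagQF h2 hq'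
  have hd : NondegQF (diagQF ![a, -1, b]) :=
    nondegQF_diagQF h2 fun i => by fin_cases i <;> simp [ha, hb]
  obtain ⟨e'⟩ := nonempty_algEquiv_of_similarQF h2 hq hd hqd
  obtain ⟨c, hc, f, hf⟩ := hqw.exists_linearEquiv
  obtain ⟨E, _, _, x, hx⟩ := exists_isGenericZero h2 hd
  obtain ⟨eE⟩ := hx.nonempty_algEquiv h2 hd
  have : Nontrivial (quadricFunctionField (diagQF ![a, -1, b])) := eE.toEquiv.nontrivial
  have hwaniso (v : Fin 3 → k) (hv : ∑ i, w i * v i ^ 2 = 0) : v = 0 := by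
    have h := hf (f.symm v)
    rw [f.apply_symm_apply, diagQF_apply, hv] at h
    exact f.symm.map_eq_zero_iff.mp (haniso _ ((mul_eq_zero.mp h.symm).resolve_left hc))
  obtain ⟨v, hv2, hv⟩ := exists_zero_functionField q'
  let g := (e.symm.trans e').toAlgHom
  have hg := map_extendQF q' g v
  rw [hv, map_zero] at hg
  refine hqd.trans hq (.trans hd ?_ (hqw.symm (nondegQF_diagQF h2 hw)))
  refine similarQF_diagQF_of_functionField h2 hw hwaniso ha hb
    (v := extendLin f.toLinearMap _ fun i => g (v i)) (fun h => ?_) ?_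
  · have h' := congrArg (extendLin f.symm.toLinearMap _) h
    rw [← extendLin_comp, LinearEquiv.symm_comp, extendLin_id] at h'
    have h2 := congrFun h' 2
    rw [hv2, map_one] at h2
    simp [extendLin] at h2
  · rw [extendQF_extendLin h2 hf, ← hg, mul_zero]

theorem similarQF_of_isotropic (h2 : (2 : k) ≠ 0) {q : QuadraticForm k (Fin 3 → k)}
    (hq : NondegQF q) {v : Fin 3 → k} (hv : q v = 0) (hv0 : v ≠ 0) :
    SimilarQF (diagQF ![-1, -1, 1]) q := by
  obtain ⟨w, hw, hqw⟩ := exists_similarQF_diagQF h2 hq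
  obtain ⟨c, hc, f, hf⟩ := hqw.exists_linearEquiv
  refine .trans (nondegQF_diagQF h2 fun i => by fin_cases i <;> simp)
    (similarQF_diagQF_of_isotropic h2 hw (v := f v) (f.map_ne_zero_iff.mpr hv0) ?_)
    (hqw.symm (nondegQF_diagQF h2 hw))
  rw [hf, hv, mul_zero]

end ConicFunctionField

theorem stmt_16 (k : Type u) [Field k] (h2 : (2 : k) ≠ 0)
    (q q' : QuadraticForm k (Fin 3 → k)) (hq : NondegQF q) (hq' : NondegQF q') :
    Nonempty (quadricFunctionField q ≃ₐ[k] quadricFunctionField q') ↔ SimilarQF q q' := by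
  refine ⟨fun ⟨e⟩ => ?_, nonempty_algEquiv_of_similarQF h2 hq hq'⟩
  by_cases h' : ∀ v, q' v = 0 → v = 0
  · exact similarQF_of_algEquiv_of_anisotropic h2 hq hq' h' e
  by_cases h : ∀ v, q v = 0 → v = 0
  · exact (similarQF_of_algEquiv_of_anisotropic h2 hq' hq h e.symm).symm hq
  push Not at h h'
  obtain ⟨v, hv, hv0⟩ := h
  obtain ⟨v', hv', hv0'⟩ := h'
  exact ((similarQF_of_isotropic h2 hq hv hv0).symm hq).trans hq
    (similarQF_of_isotropic h2 hq' hv' hv0')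

end
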